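/- For all (j,k,n) ∈ ℤ³ with j+k+n odd, n ≥ 1 and |j|+|k| < n, each direction (ι,ι′) ∈ {(1,0),(0,1),(−1,0),(0,−1)}, and all radii r₁, r₂ ∈ (0, 1/2): T_n(j+ι, k+ι′) − T_n(j,k) = (1/(2πi)²) ∮_{E₂} ∮_{E₁} R(z,w) · G_{ι,ι′}(z,w) · G_T(z,w) dz dw, where T_n(j+ι, k+ι′) = T(j+ι, k+ι′, n+1) and T_n(j,k) = T(j,k,n). -/

import Mathlib

noncomputable section

/-- A function `f : ℤ³ → ℂ` solves the Aztec system with data `(b0, bE, bN, bW, bS)`.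
Only the values on `Λ = {(j,k,n) : j+k+n odd}` are relevant/constrained. -/
def SolvesAztec (b0 bE bN bW bS : ℂ) (f : ℤ → ℤ → ℤ → ℂ) : Prop :=
  (∀ j k : ℤ, Odd (j + k) → f j k 0 = 0) ∧
  (∀ j k : ℤ, Even (j + k) → f j k (-1) = 0) ∧
  (∀ j k n : ℤ, Even (j + k + n) →
    f j k (n + 1) + f j k (n - 1)
      - (1/2) * (f (j-1) k n + f (j+1) k n + f j (k+1) n + f j (k-1) n)
    = (if j = 0 ∧ k = 0 ∧ n = 0 then b0 else 0)
      + (1/2) * ((if j = n ∧ k = 0 then bE else 0)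
               + (if j = -n ∧ k = 0 then bW else 0)
               + (if j = 0 ∧ k = n then bN else 0)
               + (if j = 0 ∧ k = -n then bS else 0)))

/-- The rational function `R(z,w) = wᵃ(z+1)ᵇ(z−1)ᶜ / ((w+1)ᵇ(w−1)ᶜ zᵃ)` with
`a = (n+1+j+k)/2`, `b = (n+1−j+k)/2`, `c = (n+1+j−k)/2`. -/
noncomputable def Rfun (j k n : ℤ) (z w : ℂ) : ℂ :=
  w ^ ((n+1+j+k)/2) * (z+1) ^ ((n+1-j+k)/2) * (z-1) ^ ((n+1+j-k)/2) /
    ((w+1) ^ ((n+1-j+k)/2) * (w-1) ^ ((n+1+j-k)/2) * z ^ ((n+1+j+k)/2))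

/-- `G_T(z,w) = (1−i)(z−i)(w−i)/((z−1)(z+1)w)`. -/
noncomputable def GT (z w : ℂ) : ℂ :=
  (1 - Complex.I) * (z - Complex.I) * (w - Complex.I) / ((z - 1) * (z + 1) * w)

/-- `G_{ι,ι′}` for the four possible directions `(ι,ι′)`. -/
noncomputable def Gdir (i1 i2 : ℤ) (z w : ℂ) : ℂ :=
  if i1 = 1 ∧ i2 = 0 then 1 / (z * (w - 1))
  else if i1 = 0 ∧ i2 = 1 then -(1 / (z * (w + 1)))
  else if i1 = -1 ∧ i2 = 0 then 1 / (w + 1)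
  else if i1 = 0 ∧ i2 = -1 then 1 / (w - 1)
  else 0

/-- The linear relations between the one-variable residues at `0` (`Z`) and at `1` (`W`) of
`(v - i) vᵖ (v + 1)^q (v - 1)^s`, together with the values that determine them. -/
structure IsResidueSystem (Z W : ℤ → ℤ → ℤ → ℂ) : Prop where
  left_add_one (a b c : ℤ) : Z a (b + 1) c = Z (a - 1) b c + Z a b c
  left_sub_one (a b c : ℤ) : Z a b (c + 1) = Z (a - 1) b c - Z a b c
  left_zero (b c : ℤ) : Z 0 b c = 0
  left_base (a : ℤ) : Z a 0 0 = if a = 2 then 1 else if a = 1 then -Complex.I else 0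
  right_add_one (a b c : ℤ) : W a b c = W (a + 1) (b + 1) c + W a (b + 1) c
  right_sub_one (a b c : ℤ) : W a b c = W (a + 1) b (c + 1) - W a b (c + 1)
  right_zero (a b : ℤ) : W a b 0 = 0
  right_base (c : ℤ) : W 0 0 c = if c = 2 then 1 else if c = 1 then 1 - Complex.I else 0

/-- The increment of the potential in direction `(1, 0)`, as a product of residues. -/
def edgeE (Z W : ℤ → ℤ → ℤ → ℂ) (a b c : ℤ) : ℂ :=
  (1 - Complex.I) * Z (a + 1) (b - 1) (c - 1) * W (a - 1) b (c + 1)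

/-- The increment of the potential in direction `(0, 1)`, as a product of residues. -/
def edgeN (Z W : ℤ → ℤ → ℤ → ℂ) (a b c : ℤ) : ℂ :=
  -((1 - Complex.I) * Z (a + 1) (b - 1) (c - 1) * W (a - 1) (b + 1) c)

/-- The increment of the potential in direction `(-1, 0)`, as a product of residues. -/
def edgeW (Z W : ℤ → ℤ → ℤ → ℂ) (a b c : ℤ) : ℂ :=
  (1 - Complex.I) * Z a (b - 1) (c - 1) * W (a - 1) (b + 1) c

/-- The increment of the potential in direction `(0, -1)`, as a product of residues. -/
def edgeS (Z W : ℤ → ℤ → ℤ → ℂ) (a b c : ℤ) : ℂ :=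
  (1 - Complex.I) * Z a (b - 1) (c - 1) * W (a - 1) b (c + 1)

/-- The sum of the four increments at a point. -/
def edgeSum (Z W : ℤ → ℤ → ℤ → ℂ) (a b c : ℤ) : ℂ :=
  edgeE Z W a b c + edgeN Z W a b c + edgeW Z W a b c + edgeS Z W a b c

namespace IsResidueSystem

variable {Z W : ℤ → ℤ → ℤ → ℂ}

theorem left_eq_zero_aux (h : IsResidueSystem Z W) (b c : ℕ) (a : ℤ) (ha : (b : ℤ) + c + 3 ≤ a) :
    Z a b c = 0 := by
  induction b generalizing a with
  | zero =>
    induction c generalizing a with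
    | zero =>
      have := h.left_base a
      grind
    | succ c ih =>
      have := h.left_sub_one a 0 c
      grind
  | succ b ih =>
    have := h.left_add_one a b c
    grind

theorem left_eq_zero (h : IsResidueSystem Z W) {a b c : ℤ} (hb : 0 ≤ b) (hc : 0 ≤ c)
    (ha : b + c + 3 ≤ a) :
    Z a b c = 0 := by
  lift b to ℕ using hb
  lift c to ℕ using hc
  exact h.left_eq_zero_aux b c a ha

theorem right_eq_zero_aux (h : IsResidueSystem Z W) (a : ℕ) (c : ℤ) (hc : (a : ℤ) + 3 ≤ c) :
    W a 0 c = 0 := by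
  induction a generalizing c with
  | zero =>
    have := h.right_base c
    grind
  | succ a ih =>
    have := h.right_sub_one a 0 (c - 1)
    grind

theorem right_eq_zero (h : IsResidueSystem Z W) {a c : ℤ} (ha : 0 ≤ a) (hc : a + 3 ≤ c) :
    W a 0 c = 0 := by
  lift a to ℕ using ha
  exact h.right_eq_zero_aux a c hc

theorem edgeE_eq (h : IsResidueSystem Z W) (a b c : ℤ) :
    edgeE Z W a b c = edgeSum Z W a (b - 1) c / 2 - edgeW Z W a (b - 1) c := by
  have l1 := h.left_add_one (a + 1) (b - 2) (c - 1)
  have r1 := h.right_add_one (a - 1) (b - 1) (c + 1)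
  have r2 := h.right_sub_one (a - 1) b c
  simp only [edgeSum, edgeE, edgeN, edgeW, edgeS]
  grind

theorem edgeN_eq (h : IsResidueSystem Z W) (a b c : ℤ) :
    edgeN Z W a b c = edgeSum Z W a b (c - 1) / 2 - edgeS Z W a b (c - 1) := by
  have l2 := h.left_sub_one (a + 1) (b - 1) (c - 2)
  have r3 := h.right_add_one (a - 1) b c
  have r4 := h.right_sub_one (a - 1) (b + 1) (c - 1)
  simp only [edgeSum, edgeE, edgeN, edgeW, edgeS]
  grind

theorem edgeW_eq (h : IsResidueSystem Z W) (a b c : ℤ) :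
    edgeW Z W a b c = edgeSum Z W (a - 1) b (c - 1) / 2 - edgeE Z W (a - 1) b (c - 1) := by
  have l4 := h.left_sub_one a (b - 1) (c - 2)
  have r7 := h.right_add_one (a - 2) b c
  have r8 := h.right_sub_one (a - 2) (b + 1) (c - 1)
  simp only [edgeSum, edgeE, edgeN, edgeW, edgeS]
  grind

theorem edgeS_eq (h : IsResidueSystem Z W) (a b c : ℤ) :
    edgeS Z W a b c = edgeSum Z W (a - 1) (b - 1) c / 2 - edgeN Z W (a - 1) (b - 1) c := by
  have l3 := h.left_add_one a (b - 2) (c - 1)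
  have r5 := h.right_add_one (a - 2) (b - 1) (c + 1)
  have r6 := h.right_sub_one (a - 2) b c
  simp only [edgeSum, edgeE, edgeN, edgeW, edgeS]
  grind

theorem edgeE_eq_of_top (h : IsResidueSystem Z W) {a b c : ℤ} (hb : 2 ≤ b) (hc : 1 ≤ c)
    (hd : b + c = a + 1) :
    edgeE Z W a b c = (edgeE Z W (a - 1) (b - 1) c - edgeN Z W (a - 1) (b - 1) c) / 2 := by
  have l1 := h.left_add_one (a + 1) (b - 2) (c - 1)
  have r5 := h.right_add_one (a - 2) (b - 1) (c + 1)
  have r6 := h.right_sub_one (a - 2) b c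
  have z := h.left_eq_zero (a := a + 1) (b := b - 2) (c := c - 1) (by lia) (by lia) (by lia)
  simp only [edgeE, edgeN]
  grind

theorem edgeN_eq_of_top (h : IsResidueSystem Z W) {a b c : ℤ} (hb : 1 ≤ b) (hc : 2 ≤ c)
    (hd : b + c = a + 1) :
    edgeN Z W a b c = (edgeN Z W (a - 1) b (c - 1) - edgeE Z W (a - 1) b (c - 1)) / 2 := by
  have l2 := h.left_sub_one (a + 1) (b - 1) (c - 2)
  have r7 := h.right_add_one (a - 2) b c
  have r8 := h.right_sub_one (a - 2) (b + 1) (c - 1)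
  have z := h.left_eq_zero (a := a + 1) (b := b - 1) (c := c - 2) (by lia) (by lia) (by lia)
  simp only [edgeE, edgeN]
  grind

theorem edgeE_eq_of_left (h : IsResidueSystem Z W) {a b c : ℤ} (ha : 1 ≤ a) (hb : b = 1)
    (hac : a < c) :
    edgeE Z W a b c = (edgeE Z W a b (c - 1) - edgeS Z W a b (c - 1)) / 2 := by
  have l2 := h.left_sub_one (a + 1) (b - 1) (c - 2)
  have r1 := h.right_add_one (a - 1) (b - 1) (c + 1)
  have r2 := h.right_sub_one (a - 1) b c
  have z := h.right_eq_zero (a := a - 1) (c := c + 1) (by lia) (by lia)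
  simp only [edgeE, edgeS]
  grind

theorem edgeS_eq_of_left (h : IsResidueSystem Z W) {a b c : ℤ} (ha : 2 ≤ a) (hb : b = 1)
    (hac : a ≤ c) :
    edgeS Z W a b c = (edgeS Z W (a - 1) b (c - 1) - edgeE Z W (a - 1) b (c - 1)) / 2 := by
  have l4 := h.left_sub_one a (b - 1) (c - 2)
  have r5 := h.right_add_one (a - 2) (b - 1) (c + 1)
  have r6 := h.right_sub_one (a - 2) b c
  have z := h.right_eq_zero (a := a - 2) (c := c + 1) (by lia) (by lia)
  simp only [edgeE, edgeS]
  grind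

theorem edgeW_eq_of_bottom (h : IsResidueSystem Z W) {a b c : ℤ} (ha : a = 1) :
    edgeW Z W a b c = (edgeW Z W a b (c - 1) - edgeS Z W a b (c - 1)) / 2 := by
  have l4 := h.left_sub_one a (b - 1) (c - 2)
  have r3 := h.right_add_one (a - 1) b c
  have r4 := h.right_sub_one (a - 1) (b + 1) (c - 1)
  have z := h.left_zero (b - 1) (c - 2)
  simp only [edgeW, edgeS]
  grind

theorem edgeS_eq_of_bottom (h : IsResidueSystem Z W) {a b c : ℤ} (ha : a = 1) :
    edgeS Z W a b c = (edgeS Z W a (b - 1) c - edgeW Z W a (b - 1) c) / 2 := by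
  have l3 := h.left_add_one a (b - 2) (c - 1)
  have r1 := h.right_add_one (a - 1) (b - 1) (c + 1)
  have r2 := h.right_sub_one (a - 1) b c
  have z := h.left_zero (b - 2) (c - 1)
  simp only [edgeW, edgeS]
  grind

theorem edgeN_eq_of_right (h : IsResidueSystem Z W) {a b c : ℤ} (hc : c = 1) :
    edgeN Z W a b c = (edgeN Z W a (b - 1) c - edgeW Z W a (b - 1) c) / 2 := by
  have l1 := h.left_add_one (a + 1) (b - 2) (c - 1)
  have r3 := h.right_add_one (a - 1) b c
  have r4 := h.right_sub_one (a - 1) (b + 1) (c - 1)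
  have z := h.right_zero (a - 1) (b + 1)
  simp only [edgeN, edgeW]
  grind

theorem edgeW_eq_of_right (h : IsResidueSystem Z W) {a b c : ℤ} (hc : c = 1) :
    edgeW Z W a b c = (edgeW Z W (a - 1) (b - 1) c - edgeN Z W (a - 1) (b - 1) c) / 2 := by
  have l3 := h.left_add_one a (b - 2) (c - 1)
  have r7 := h.right_add_one (a - 2) b c
  have r8 := h.right_sub_one (a - 2) (b + 1) (c - 1)
  have z := h.right_zero (a - 2) (b + 1)
  simp only [edgeN, edgeW]
  grind

theorem edgeE_axis_succ (h : IsResidueSystem Z W) {a : ℤ} (ha : 1 ≤ a) :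
    edgeE Z W (a + 1) 1 (a + 1) = edgeE Z W a 1 a / 2 := by
  have z := h.left_eq_zero (a := a + 2) (b := 0) (c := a - 1) (by lia) (by lia) (by lia)
  have l := h.left_sub_one (a + 2) 0 (a - 1)
  have w := h.right_eq_zero (a := a - 1) (c := a + 2) (by lia) (by lia)
  have r1 := h.right_add_one (a - 1) 0 (a + 2)
  have r2 := h.right_sub_one (a - 1) 1 (a + 1)
  simp only [edgeE]
  grind

theorem edgeN_axis_succ (h : IsResidueSystem Z W) {a : ℤ} (ha : 1 ≤ a) :
    edgeN Z W (a + 1) (a + 1) 1 = edgeN Z W a a 1 / 2 := by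
  have z := h.left_eq_zero (a := a + 2) (b := a - 1) (c := 0) (by lia) (by lia) (by lia)
  have l := h.left_add_one (a + 2) (a - 1) 0
  have w := h.right_zero (a - 1) (a + 2)
  have r1 := h.right_add_one (a - 1) (a + 1) 1
  have r2 := h.right_sub_one (a - 1) (a + 2) 0
  simp only [edgeN]
  grind

theorem edgeW_axis_succ (h : IsResidueSystem Z W) (b : ℤ) :
    edgeW Z W 1 (b + 1) 1 = edgeW Z W 1 b 1 / 2 := by
  have z := h.left_zero (b - 1) 0
  have l := h.left_add_one 1 (b - 1) 0
  have w := h.right_zero 0 (b + 2)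
  have r1 := h.right_add_one 0 (b + 1) 1
  have r2 := h.right_sub_one 0 (b + 2) 0
  simp only [edgeW]
  grind

theorem edgeS_axis_succ (h : IsResidueSystem Z W) {c : ℤ} (hc : 1 ≤ c) :
    edgeS Z W 1 1 (c + 1) = edgeS Z W 1 1 c / 2 := by
  have z := h.left_zero 0 (c - 1)
  have l := h.left_sub_one 1 0 (c - 1)
  have w := h.right_eq_zero (a := 0) (c := c + 2) (by lia) (by lia)
  have r1 := h.right_add_one 0 0 (c + 2)
  have r2 := h.right_sub_one 0 1 (c + 1)
  simp only [edgeS]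
  grind

theorem right_values (h : IsResidueSystem Z W) :
    W 0 1 2 = (1 + Complex.I) / 4 ∧ W 0 2 1 = (1 - Complex.I) / 4 := by
  have b1 := h.right_base 1
  have b2 := h.right_base 2
  have z1 := h.right_zero 0 1
  have z2 := h.right_zero 0 2
  have p1 := h.right_add_one 0 0 1
  have p2 := h.right_add_one 0 0 2
  have p3 := h.right_add_one 0 1 1
  have q1 := h.right_sub_one 0 1 0
  have q2 := h.right_sub_one 0 1 1
  have q3 := h.right_sub_one 0 2 0
  norm_num at b1 b2 p1 p2 p3 q1 q2 q3
  grind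

theorem edge_one_one_one (h : IsResidueSystem Z W) :
    edgeE Z W 1 1 1 = 1 / 2 ∧ edgeN Z W 1 1 1 = Complex.I / 2 ∧
      edgeW Z W 1 1 1 = -1 / 2 ∧ edgeS Z W 1 1 1 = -Complex.I / 2 := by
  have hI := Complex.I_sq
  have z1 := h.left_base 1
  have z2 := h.left_base 2
  obtain ⟨w1, w2⟩ := h.right_values
  norm_num at z1 z2
  refine ⟨?_, ?_, ?_, ?_⟩ <;> norm_num [edgeE, edgeN, edgeW, edgeS, z1, z2, w1, w2] <;> grind

end IsResidueSystem

/-- The Aztec recurrence in the coordinates `a = (n+1+j+k)/2`, `b = (n+1-j+k)/2`,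
`c = (n+1+j-k)/2`, together with the support of its solution. -/
structure IsAztecPotential (U : ℤ → ℤ → ℤ → ℂ) : Prop where
  recurrence (a b c : ℤ) : U (a + 1) (b + 1) (c + 1) + U a b c
      - (U (a + 1) b (c + 1) + U (a + 1) (b + 1) c + U a (b + 1) c + U a b (c + 1)) / 2 =
    ((if b = 0 ∧ a = c then 1 else 0) + (if a = 0 ∧ c = 0 then -1 else 0)
      + (if c = 0 ∧ a = b then Complex.I else 0)
      + (if a = 0 ∧ b = 0 then -Complex.I else 0)) / 2
  eq_zero (a b c : ℤ) (hbc : 0 ≤ b + c) (h : a ≤ 0 ∨ b ≤ 0 ∨ c ≤ 0 ∨ b + c ≤ a) : U a b c = 0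

/-- The increments of `U` at `(a, b, c)` in the four directions are the products of residues. -/
def HasEdges (Z W U : ℤ → ℤ → ℤ → ℂ) (a b c : ℤ) : Prop :=
  U (a + 1) b (c + 1) - U a b c = edgeE Z W a b c ∧
  U (a + 1) (b + 1) c - U a b c = edgeN Z W a b c ∧
  U a (b + 1) c - U a b c = edgeW Z W a b c ∧
  U a b (c + 1) - U a b c = edgeS Z W a b c

namespace IsAztecPotential

variable {Z W U : ℤ → ℤ → ℤ → ℂ}

theorem one_one_one (hU : IsAztecPotential U) : U 1 1 1 = 0 := by
  have h := hU.recurrence 0 0 0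
  have h0 := hU.eq_zero 0 0 0 (by lia) (by lia)
  have h1 := hU.eq_zero 1 0 1 (by lia) (by lia)
  have h2 := hU.eq_zero 1 1 0 (by lia) (by lia)
  have h3 := hU.eq_zero 0 1 0 (by lia) (by lia)
  have h4 := hU.eq_zero 0 0 1 (by lia) (by lia)
  norm_num [h0, h1, h2, h3, h4] at h
  exact h

theorem sub_eq_edgeE (hU : IsAztecPotential U) (h : IsResidueSystem Z W) {a b c : ℤ}
    (ha : 1 ≤ a) (hb : 1 ≤ b) (hc : 1 ≤ c) (hd : a < b + c)
    (ih : ∀ a' b' c', 1 ≤ a' → 1 ≤ b' → 1 ≤ c' → a' < b' + c' → b' + c' = b + c - 1 →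
      HasEdges Z W U a' b' c') :
    U (a + 1) b (c + 1) - U a b c = edgeE Z W a b c := by
  have z := hU.eq_zero
  have e := hU.recurrence a (b - 1) c
  by_cases h1 : 2 ≤ b <;> by_cases h2 : a + 2 ≤ b + c
  · obtain ⟨i1, i2, i3, i4⟩ := ih a (b - 1) c (by lia) (by lia) (by lia) (by lia) (by lia)
    have := h.edgeE_eq a b c
    simp only [edgeSum] at this
    grind
  · obtain ⟨i1, i2, i3, i4⟩ := ih (a - 1) (b - 1) c (by lia) (by lia) (by lia) (by lia) (by lia)
    have := h.edgeE_eq_of_top (a := a) (b := b) (c := c)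
    grind
  · obtain ⟨i1, i2, i3, i4⟩ := ih a b (c - 1) (by lia) (by lia) (by lia) (by lia) (by lia)
    have := h.edgeE_eq_of_left (a := a) (b := b) (c := c)
    grind
  · obtain rfl : b = 1 := by lia
    obtain rfl : a = c := by lia
    by_cases h3 : a = 1
    · subst h3
      have u := hU.one_one_one
      have v := h.edge_one_one_one
      grind
    · obtain ⟨i1, i2, i3, i4⟩ := ih (a - 1) 1 (a - 1) (by lia) (by lia) (by lia) (by lia) (by lia)
      have e' := hU.recurrence (a - 1) 0 (a - 1)
      have := h.edgeE_axis_succ (a := a - 1) (by lia)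
      grind

theorem sub_eq_edgeN (hU : IsAztecPotential U) (h : IsResidueSystem Z W) {a b c : ℤ}
    (ha : 1 ≤ a) (hb : 1 ≤ b) (hc : 1 ≤ c) (hd : a < b + c)
    (ih : ∀ a' b' c', 1 ≤ a' → 1 ≤ b' → 1 ≤ c' → a' < b' + c' → b' + c' = b + c - 1 →
      HasEdges Z W U a' b' c') :
    U (a + 1) (b + 1) c - U a b c = edgeN Z W a b c := by
  have z := hU.eq_zero
  have e := hU.recurrence a b (c - 1)
  by_cases h1 : 2 ≤ c <;> by_cases h2 : a + 2 ≤ b + c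
  · obtain ⟨i1, i2, i3, i4⟩ := ih a b (c - 1) (by lia) (by lia) (by lia) (by lia) (by lia)
    have := h.edgeN_eq a b c
    simp only [edgeSum] at this
    grind
  · obtain ⟨i1, i2, i3, i4⟩ := ih (a - 1) b (c - 1) (by lia) (by lia) (by lia) (by lia) (by lia)
    have := h.edgeN_eq_of_top (a := a) (b := b) (c := c)
    grind
  · obtain ⟨i1, i2, i3, i4⟩ := ih a (b - 1) c (by lia) (by lia) (by lia) (by lia) (by lia)
    have := h.edgeN_eq_of_right (a := a) (b := b) (c := c)
    grind
  · obtain rfl : c = 1 := by lia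
    obtain rfl : a = b := by lia
    by_cases h3 : a = 1
    · subst h3
      have u := hU.one_one_one
      have v := h.edge_one_one_one
      grind
    · obtain ⟨i1, i2, i3, i4⟩ := ih (a - 1) (a - 1) 1 (by lia) (by lia) (by lia) (by lia) (by lia)
      have e' := hU.recurrence (a - 1) (a - 1) 0
      have := h.edgeN_axis_succ (a := a - 1) (by lia)
      grind

theorem sub_eq_edgeW (hU : IsAztecPotential U) (h : IsResidueSystem Z W) {a b c : ℤ}
    (ha : 1 ≤ a) (hb : 1 ≤ b) (hc : 1 ≤ c) (hd : a < b + c)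
    (ih : ∀ a' b' c', 1 ≤ a' → 1 ≤ b' → 1 ≤ c' → a' < b' + c' → b' + c' = b + c - 1 →
      HasEdges Z W U a' b' c') :
    U a (b + 1) c - U a b c = edgeW Z W a b c := by
  have z := hU.eq_zero
  have e := hU.recurrence (a - 1) b (c - 1)
  by_cases h1 : 2 ≤ c <;> by_cases h2 : 2 ≤ a
  · obtain ⟨i1, i2, i3, i4⟩ := ih (a - 1) b (c - 1) (by lia) (by lia) (by lia) (by lia) (by lia)
    have := h.edgeW_eq a b c
    simp only [edgeSum] at this
    grind
  · obtain ⟨i1, i2, i3, i4⟩ := ih a b (c - 1) (by lia) (by lia) (by lia) (by lia) (by lia)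
    have := h.edgeW_eq_of_bottom (a := a) (b := b) (c := c)
    grind
  · obtain ⟨i1, i2, i3, i4⟩ := ih (a - 1) (b - 1) c (by lia) (by lia) (by lia) (by lia) (by lia)
    have := h.edgeW_eq_of_right (a := a) (b := b) (c := c)
    grind
  · obtain rfl : a = 1 := by lia
    obtain rfl : c = 1 := by lia
    by_cases h3 : b = 1
    · subst h3
      have u := hU.one_one_one
      have v := h.edge_one_one_one
      grind
    · obtain ⟨i1, i2, i3, i4⟩ := ih 1 (b - 1) 1 (by lia) (by lia) (by lia) (by lia) (by lia)
      have e' := hU.recurrence 0 (b - 1) 0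
      have := h.edgeW_axis_succ (b - 1)
      grind

theorem sub_eq_edgeS (hU : IsAztecPotential U) (h : IsResidueSystem Z W) {a b c : ℤ}
    (ha : 1 ≤ a) (hb : 1 ≤ b) (hc : 1 ≤ c) (hd : a < b + c)
    (ih : ∀ a' b' c', 1 ≤ a' → 1 ≤ b' → 1 ≤ c' → a' < b' + c' → b' + c' = b + c - 1 →
      HasEdges Z W U a' b' c') :
    U a b (c + 1) - U a b c = edgeS Z W a b c := by
  have z := hU.eq_zero
  have e := hU.recurrence (a - 1) (b - 1) c
  by_cases h1 : 2 ≤ b <;> by_cases h2 : 2 ≤ a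
  · obtain ⟨i1, i2, i3, i4⟩ := ih (a - 1) (b - 1) c (by lia) (by lia) (by lia) (by lia) (by lia)
    have := h.edgeS_eq a b c
    simp only [edgeSum] at this
    grind
  · obtain ⟨i1, i2, i3, i4⟩ := ih a (b - 1) c (by lia) (by lia) (by lia) (by lia) (by lia)
    have := h.edgeS_eq_of_bottom (a := a) (b := b) (c := c)
    grind
  · obtain ⟨i1, i2, i3, i4⟩ := ih (a - 1) b (c - 1) (by lia) (by lia) (by lia) (by lia) (by lia)
    have := h.edgeS_eq_of_left (a := a) (b := b) (c := c)
    grind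
  · obtain rfl : a = 1 := by lia
    obtain rfl : b = 1 := by lia
    by_cases h3 : c = 1
    · subst h3
      have u := hU.one_one_one
      have v := h.edge_one_one_one
      grind
    · obtain ⟨i1, i2, i3, i4⟩ := ih 1 1 (c - 1) (by lia) (by lia) (by lia) (by lia) (by lia)
      have e' := hU.recurrence 0 0 (c - 1)
      have := h.edgeS_axis_succ (c := c - 1) (by lia)
      grind

theorem hasEdges (hU : IsAztecPotential U) (h : IsResidueSystem Z W) (m : ℕ) :
    ∀ a b c : ℤ, 1 ≤ a → 1 ≤ b → 1 ≤ c → a < b + c → b + c = m → HasEdges Z W U a b c := by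
  induction m with
  | zero => lia
  | succ m ih =>
    intro a b c ha hb hc hd hm
    have ih' : ∀ a' b' c' : ℤ, 1 ≤ a' → 1 ≤ b' → 1 ≤ c' → a' < b' + c' → b' + c' = b + c - 1 →
        HasEdges Z W U a' b' c' :=
      fun a' b' c' ha' hb' hc' hd' hm' => ih a' b' c' ha' hb' hc' hd' (by lia)
    exact ⟨hU.sub_eq_edgeE h ha hb hc hd ih', hU.sub_eq_edgeN h ha hb hc hd ih',
      hU.sub_eq_edgeW h ha hb hc hd ih', hU.sub_eq_edgeS h ha hb hc hd ih'⟩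

end IsAztecPotential

/-- The normalised contour integral of `(v - i) v^p (v + 1)^q (v - 1)^s` over a circle. -/
def laurentIntegral (x : ℂ) (r : ℝ) (p q s : ℤ) : ℂ :=
  (2 * (Real.pi : ℂ) * Complex.I)⁻¹ *
    ∮ v in C(x, r), (v - Complex.I) * v ^ p * (v + 1) ^ q * (v - 1) ^ s

section LaurentIntegral

variable {x : ℂ} {r : ℝ}

theorem circleIntegrable_laurent (hr : 0 < r)
    (hx : ∀ v ∈ Metric.sphere x r, v ≠ 0 ∧ v + 1 ≠ 0 ∧ v - 1 ≠ 0) (p q s : ℤ) :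
    CircleIntegrable (fun v => (v - Complex.I) * v ^ p * (v + 1) ^ q * (v - 1) ^ s) x r := by
  refine ContinuousOn.circleIntegrable hr.le fun v hv => ContinuousAt.continuousWithinAt ?_
  obtain ⟨h0, h1, h2⟩ := hx v hv
  have c1 : ContinuousAt (fun v : ℂ => v ^ p) v := continuousAt_id.zpow₀ p (Or.inl h0)
  have c2 : ContinuousAt (fun v : ℂ => (v + 1) ^ q) v :=
    ContinuousAt.zpow₀ (by fun_prop) q (Or.inl h1)
  have c3 : ContinuousAt (fun v : ℂ => (v - 1) ^ s) v :=
    ContinuousAt.zpow₀ (by fun_prop) s (Or.inl h2)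
  fun_prop

theorem laurentIntegral_add_one (hr : 0 < r)
    (hx : ∀ v ∈ Metric.sphere x r, v ≠ 0 ∧ v + 1 ≠ 0 ∧ v - 1 ≠ 0) (p q s : ℤ) :
    laurentIntegral x r p (q + 1) s =
      laurentIntegral x r (p + 1) q s + laurentIntegral x r p q s := by
  simp only [laurentIntegral]
  rw [← mul_add, ← circleIntegral.integral_add (circleIntegrable_laurent hr hx _ _ _)
    (circleIntegrable_laurent hr hx _ _ _)]
  congr 1
  refine circleIntegral.integral_congr hr.le fun v hv => ?_
  obtain ⟨h0, h1, h2⟩ := hx v hv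
  simp only [zpow_add_one₀ h0, zpow_add_one₀ h1]
  ring

theorem laurentIntegral_sub_one (hr : 0 < r)
    (hx : ∀ v ∈ Metric.sphere x r, v ≠ 0 ∧ v + 1 ≠ 0 ∧ v - 1 ≠ 0) (p q s : ℤ) :
    laurentIntegral x r p q (s + 1) =
      laurentIntegral x r (p + 1) q s - laurentIntegral x r p q s := by
  simp only [laurentIntegral]
  rw [← mul_sub, ← circleIntegral.integral_sub (circleIntegrable_laurent hr hx _ _ _)
    (circleIntegrable_laurent hr hx _ _ _)]
  congr 1
  refine circleIntegral.integral_congr hr.le fun v hv => ?_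
  obtain ⟨h0, h1, h2⟩ := hx v hv
  simp only [zpow_add_one₀ h0, zpow_add_one₀ h2]
  ring

theorem circleIntegral_sub_zpow_neg (hr : 0 < r) (a : ℤ) :
    (2 * (Real.pi : ℂ) * Complex.I)⁻¹ * ∮ v in C(x, r), (v - Complex.I) * (v - x) ^ (-a) =
      if a = 2 then 1 else if a = 1 then x - Complex.I else 0 := by
  have hpi : 2 * (Real.pi : ℂ) * Complex.I ≠ 0 := Complex.two_pi_I_ne_zero
  have hne : ∀ v ∈ Metric.sphere x r, v - x ≠ 0 := fun v hv =>
    sub_ne_zero.2 (ne_of_mem_of_not_mem hv (by simp [hr.ne]))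
  have hzpow : ∀ m : ℤ, CircleIntegrable (fun v => (v - x) ^ m) x r := fun m =>
    circleIntegrable_sub_zpow_iff.2 (by simp [abs_of_pos hr, hr.ne])
  have hval : ∀ m : ℤ, (∮ v in C(x, r), (v - x) ^ m) =
      if m = -1 then 2 * (Real.pi : ℂ) * Complex.I else 0 := by
    intro m
    split_ifs with hm
    · subst hm
      simpa using circleIntegral.integral_sub_center_inv x hr.ne'
    · exact circleIntegral.integral_sub_zpow_of_ne hm x x r
  have key : (∮ v in C(x, r), (v - Complex.I) * (v - x) ^ (-a)) =
      (∮ v in C(x, r), (v - x) ^ (-a + 1)) + ∮ v in C(x, r), (x - Complex.I) * (v - x) ^ (-a) := by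
    have hconst : CircleIntegrable (fun v => (x - Complex.I) * (v - x) ^ (-a)) x r :=
      (hzpow _).const_smul
    rw [← circleIntegral.integral_add (hzpow _) hconst]
    refine circleIntegral.integral_congr hr.le fun v hv => ?_
    simp only [zpow_add_one₀ (hne v hv)]
    ring
  rw [key, circleIntegral.integral_const_mul, hval, hval]
  generalize 2 * (Real.pi : ℂ) * Complex.I = t at hpi
  by_cases h2 : a = 2
  · simp [h2, hpi]
  · by_cases h1 : a = 1
    · subst h1
      norm_num
      field_simp
    · rw [if_neg (by lia), if_neg (by lia), if_neg h2, if_neg h1]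
      simp

end LaurentIntegral

theorem ne_of_mem_closedBall_zero {r : ℝ} (hr : r < 1 / 2) {v : ℂ}
    (hv : v ∈ Metric.closedBall 0 r) : v + 1 ≠ 0 ∧ v - 1 ≠ 0 := by
  rw [mem_closedBall_zero_iff] at hv
  constructor <;> intro h
  · rw [eq_neg_of_add_eq_zero_left h] at hv
    norm_num at hv
    linarith
  · rw [sub_eq_zero.1 h] at hv
    norm_num at hv
    linarith

theorem ne_of_mem_closedBall_one {r : ℝ} (hr : r < 1 / 2) {v : ℂ}
    (hv : v ∈ Metric.closedBall 1 r) : v ≠ 0 ∧ v + 1 ≠ 0 := by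
  rw [mem_closedBall_iff_norm] at hv
  constructor <;> intro h
  · rw [h] at hv
    norm_num at hv
    linarith
  · rw [eq_neg_of_add_eq_zero_left h] at hv
    norm_num at hv
    linarith

theorem ne_of_mem_sphere_zero {r : ℝ} (hr0 : 0 < r) (hr : r < 1 / 2) :
    ∀ v ∈ Metric.sphere (0 : ℂ) r, v ≠ 0 ∧ v + 1 ≠ 0 ∧ v - 1 ≠ 0 := fun _ hv =>
  ⟨ne_of_mem_of_not_mem hv (by simp [hr0.ne]),
    ne_of_mem_closedBall_zero hr (Metric.sphere_subset_closedBall hv)⟩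

theorem ne_of_mem_sphere_one {r : ℝ} (hr0 : 0 < r) (hr : r < 1 / 2) :
    ∀ v ∈ Metric.sphere (1 : ℂ) r, v ≠ 0 ∧ v + 1 ≠ 0 ∧ v - 1 ≠ 0 := fun _ hv =>
  have h := ne_of_mem_closedBall_one hr (Metric.sphere_subset_closedBall hv)
  ⟨h.1, h.2, sub_ne_zero.2 (ne_of_mem_of_not_mem hv (by simp [hr0.ne]))⟩

theorem laurentIntegral_zero_zero {r : ℝ} (hr0 : 0 < r) (hr : r < 1 / 2) (q s : ℤ) :
    laurentIntegral 0 r 0 q s = 0 := by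
  rw [laurentIntegral, DiffContOnCl.circleIntegral_eq_zero hr0.le, mul_zero]
  refine DifferentiableOn.diffContOnCl fun v hv => DifferentiableAt.differentiableWithinAt ?_
  obtain ⟨h1, h2⟩ := ne_of_mem_closedBall_zero hr (Metric.closure_ball_subset_closedBall hv)
  have c2 : DifferentiableAt ℂ (fun v : ℂ => (v + 1) ^ q) v :=
    DifferentiableAt.zpow (by fun_prop) (Or.inl h1)
  have c3 : DifferentiableAt ℂ (fun v : ℂ => (v - 1) ^ s) v :=
    DifferentiableAt.zpow (by fun_prop) (Or.inl h2)
  simp only [zpow_zero]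
  fun_prop

theorem laurentIntegral_one_zero {r : ℝ} (hr0 : 0 < r) (hr : r < 1 / 2) (p q : ℤ) :
    laurentIntegral 1 r p q 0 = 0 := by
  rw [laurentIntegral, DiffContOnCl.circleIntegral_eq_zero hr0.le, mul_zero]
  refine DifferentiableOn.diffContOnCl fun v hv => DifferentiableAt.differentiableWithinAt ?_
  obtain ⟨h0, h1⟩ := ne_of_mem_closedBall_one hr (Metric.closure_ball_subset_closedBall hv)
  have c1 : DifferentiableAt ℂ (fun v : ℂ => v ^ p) v :=
    DifferentiableAt.zpow (by fun_prop) (Or.inl h0)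
  have c2 : DifferentiableAt ℂ (fun v : ℂ => (v + 1) ^ q) v :=
    DifferentiableAt.zpow (by fun_prop) (Or.inl h1)
  simp only [zpow_zero]
  fun_prop

theorem isResidueSystem_laurentIntegral {r₁ r₂ : ℝ} (h₁ : 0 < r₁) (h₁' : r₁ < 1 / 2)
    (h₂ : 0 < r₂) (h₂' : r₂ < 1 / 2) :
    IsResidueSystem (fun a b c => laurentIntegral 0 r₁ (-a) b c)
      (fun a b c => laurentIntegral 1 r₂ a (-b) (-c)) where
  left_add_one a b c := by
    have := laurentIntegral_add_one h₁ (ne_of_mem_sphere_zero h₁ h₁') (-a) b c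
    grind
  left_sub_one a b c := by
    have := laurentIntegral_sub_one h₁ (ne_of_mem_sphere_zero h₁ h₁') (-a) b c
    grind
  left_zero b c := by simpa using laurentIntegral_zero_zero h₁ h₁' b c
  left_base a := by simpa [laurentIntegral] using circleIntegral_sub_zpow_neg (x := 0) h₁ a
  right_add_one a b c := by
    have := laurentIntegral_add_one h₂ (ne_of_mem_sphere_one h₂ h₂') a (-(b + 1)) (-c)
    grind
  right_sub_one a b c := by
    have := laurentIntegral_sub_one h₂ (ne_of_mem_sphere_one h₂ h₂') a (-b) (-(c + 1))
    grind
  right_zero a b := by simpa using laurentIntegral_one_zero h₂ h₂' a (-b)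
  right_base c := by simpa [laurentIntegral] using circleIntegral_sub_zpow_neg (x := 1) h₂ c

theorem circleIntegral_mul_eq {F : ℂ → ℂ → ℂ} {r₁ r₂ : ℝ} (h₁ : 0 < r₁) (h₂ : 0 < r₂)
    (k : ℂ) (p q s p' q' s' : ℤ)
    (hF : ∀ w ∈ Metric.sphere (1 : ℂ) r₂, ∀ z ∈ Metric.sphere (0 : ℂ) r₁,
      F z w = k * ((w - Complex.I) * w ^ p' * (w + 1) ^ q' * (w - 1) ^ s') *
        ((z - Complex.I) * z ^ p * (z + 1) ^ q * (z - 1) ^ s)) :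
    (1 / (2 * (Real.pi : ℂ) * Complex.I) ^ 2) * (∮ w in C(1, r₂), ∮ z in C(0, r₁), F z w) =
      k * laurentIntegral 0 r₁ p q s * laurentIntegral 1 r₂ p' q' s' := by
  have inner : ∀ w ∈ Metric.sphere (1 : ℂ) r₂, (∮ z in C(0, r₁), F z w) =
      (k * ∮ z in C(0, r₁), (z - Complex.I) * z ^ p * (z + 1) ^ q * (z - 1) ^ s) *
        ((w - Complex.I) * w ^ p' * (w + 1) ^ q' * (w - 1) ^ s') := by
    intro w hw
    rw [circleIntegral.integral_congr h₁.le (hF w hw), circleIntegral.integral_const_mul]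
    ring
  rw [circleIntegral.integral_congr h₂.le inner, circleIntegral.integral_const_mul]
  simp only [laurentIntegral]
  ring

theorem SolvesAztec.eq_zero_of_le {b0 bE bN bW bS : ℂ} {T : ℤ → ℤ → ℤ → ℂ}
    (hT : SolvesAztec b0 bE bN bW bS T) (m : ℕ) :
    ∀ j k : ℤ, (Odd (j + k + m) → (m : ℤ) ≤ |j| + |k| → T j k m = 0) ∧
      (Odd (j + k + (m - 1)) → (m : ℤ) - 1 ≤ |j| + |k| → T j k (m - 1) = 0) := by
  obtain ⟨hz, hn, hr⟩ := hT
  induction m with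
  | zero =>
    intro j k
    refine ⟨fun ho _ => hz j k (by simpa using ho), fun ⟨t, ht⟩ _ => ?_⟩
    simpa using hn j k ⟨t + 1, by push_cast at ht; lia⟩
  | succ m ih =>
    intro j k
    push_cast
    refine ⟨fun ⟨t, ht⟩ hjk => ?_, fun ho hjk => ?_⟩
    · have abs_step : ∀ x : ℤ, |x| ≤ |x - 1| + 1 ∧ |x| ≤ |x + 1| + 1 := fun x =>
        ⟨by have := abs_add_le (x - 1) 1; simpa using this,
          by have := abs_sub (x + 1) 1; simpa using this⟩
      obtain ⟨hj1, hj2⟩ := abs_step j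
      obtain ⟨hk1, hk2⟩ := abs_step k
      have e := hr j k m ⟨t, by lia⟩
      rw [(ih j k).2 ⟨t - 1, by lia⟩ (by lia), (ih (j - 1) k).1 ⟨t - 1, by lia⟩ (by lia),
        (ih (j + 1) k).1 ⟨t, by lia⟩ (by lia), (ih j (k + 1)).1 ⟨t, by lia⟩ (by lia),
        (ih j (k - 1)).1 ⟨t - 1, by lia⟩ (by lia)] at e
      have hm : |(m : ℤ)| = m := abs_of_nonneg (by lia)
      rw [if_neg, if_neg, if_neg, if_neg, if_neg] at e
      · simpa using e
      all_goals
        rintro ⟨h1, h2⟩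
        simp [h1, h2, hm] at hjk
    · have := (ih j k).1 (by simpa using ho) (by simpa using hjk)
      simpa using this

/-- In the corner coordinates a solution of the Aztec system with the data of the perfect
t-embedding satisfies `IsAztecPotential`. -/
theorem SolvesAztec.isAztecPotential {T : ℤ → ℤ → ℤ → ℂ}
    (hT : SolvesAztec 0 1 Complex.I (-1) (-Complex.I) T) :
    IsAztecPotential (fun a b c => T (a - b) (a - c) (b + c - 1)) where
  recurrence a b c := by
    have e := hT.2.2 (a - b) (a - c) (b + c) ⟨a, by ring⟩
    have c1 : a - b = b + c ∧ a - c = 0 ↔ b = 0 ∧ a = c := by lia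
    have c2 : a - b = -(b + c) ∧ a - c = 0 ↔ a = 0 ∧ c = 0 := by lia
    have c3 : a - b = 0 ∧ a - c = b + c ↔ c = 0 ∧ a = b := by lia
    have c4 : a - b = 0 ∧ a - c = -(b + c) ↔ a = 0 ∧ b = 0 := by lia
    simp only [c1, c2, c3, c4, ite_self, zero_add] at e
    rw [show a + 1 - (b + 1) = a - b by ring, show a + 1 - (c + 1) = a - c by ring,
      show b + 1 + (c + 1) - 1 = b + c + 1 by ring, show a + 1 - b = a - b + 1 by ring,
      show b + (c + 1) - 1 = b + c by ring, show a + 1 - c = a - c + 1 by ring,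
      show b + 1 + c - 1 = b + c by ring, show a - (b + 1) = a - b - 1 by ring,
      show a - (c + 1) = a - c - 1 by ring]
    linear_combination e
  eq_zero a b c hbc h := by
    obtain hbc | hbc := hbc.eq_or_lt
    · have := hT.2.1 (a - b) (a - c) (by grind)
      grind
    · obtain ⟨m, hm⟩ := Int.eq_ofNat_of_zero_le (show 0 ≤ b + c - 1 by lia)
      have := (hT.eq_zero_of_le m (a - b) (a - c)).1 (by grind) (by grind)
      grind

/-- Double contour integral formula for the edges of the perfect
t-embedding of the uniformly weighted Aztec diamond. -/
theorem aztec_tembedding_edge_double_contour_integral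
    (T : ℤ → ℤ → ℤ → ℂ) (hT : SolvesAztec 0 1 Complex.I (-1) (-Complex.I) T)
    (j k n : ℤ) (hodd : Odd (j + k + n)) (hn : 1 ≤ n) (hjk : |j| + |k| < n)
    (i1 i2 : ℤ) (hdir : (i1, i2) ∈ ({(1,0), (0,1), (-1,0), (0,-1)} : Set (ℤ × ℤ)))
    (r1 r2 : ℝ) (hr1 : 0 < r1) (hr1' : r1 < 1/2) (hr2 : 0 < r2) (hr2' : r2 < 1/2) :
    T (j + i1) (k + i2) (n + 1) - T j k n
      = (1 / (2 * (Real.pi : ℂ) * Complex.I)^2) *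
        (∮ w in C(1, r2), ∮ z in C(0, r1),
          Rfun j k n z w * Gdir i1 i2 z w * GT z w) := by
  obtain ⟨t, ht⟩ := hodd
  obtain ⟨a, ha⟩ : ∃ a, n + 1 + j + k = 2 * a := ⟨t + 1, by lia⟩
  obtain ⟨b, hb⟩ : ∃ b, n + 1 - j + k = 2 * b := ⟨t + 1 - j, by lia⟩
  obtain ⟨c, hc⟩ : ∃ c, n + 1 + j - k = 2 * c := ⟨t + 1 - k, by lia⟩
  have hj := abs_le.1 (le_refl |j|)
  have hk := abs_le.1 (le_refl |k|)
  obtain ⟨eE, eN, eW, eS⟩ := hT.isAztecPotential.hasEdges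
    (isResidueSystem_laurentIntegral hr1 hr1' hr2 hr2') (b + c).toNat a b c
    (by lia) (by lia) (by lia) (by lia) (by lia)
  simp only [edgeE, edgeN, edgeW, edgeS] at eE eN eW eS
  obtain rfl : j = a - b := by lia
  obtain rfl : k = a - c := by lia
  obtain rfl : n = b + c - 1 := by lia
  have h1 : (b + c - 1 + 1 + (a - b) + (a - c)) / 2 = a := by lia
  have h2 : (b + c - 1 + 1 - (a - b) + (a - c)) / 2 = b := by lia
  have h3 : (b + c - 1 + 1 + (a - b) - (a - c)) / 2 = c := by lia
  have hz := ne_of_mem_sphere_zero hr1 hr1'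
  have hw := ne_of_mem_sphere_one hr2 hr2'
  simp only [Set.mem_insert_iff, Set.mem_singleton_iff, Prod.mk.injEq] at hdir
  obtain ⟨rfl, rfl⟩ | ⟨rfl, rfl⟩ | ⟨rfl, rfl⟩ | ⟨rfl, rfl⟩ := hdir
  · refine Eq.trans ?_ (circleIntegral_mul_eq hr1 hr2 (1 - Complex.I)
      (-(a + 1)) (b - 1) (c - 1) (a - 1) (-b) (-(c + 1)) ?_).symm
    · grind
    · intro w hw' z hz'
      obtain ⟨z0, z1, z2⟩ := hz z hz'
      obtain ⟨w0, w1, w2⟩ := hw w hw'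
      have hG : Gdir 1 0 z w = 1 / (z * (w - 1)) := by simp [Gdir]
      simp only [Rfun, hG, GT, h1, h2, h3, zpow_sub_one₀ z1, zpow_sub_one₀ z2,
        zpow_sub_one₀ w0, zpow_neg, zpow_add_one₀ z0, zpow_add_one₀ w2]
      field_simp
  · refine Eq.trans ?_ (circleIntegral_mul_eq hr1 hr2 (-(1 - Complex.I))
      (-(a + 1)) (b - 1) (c - 1) (a - 1) (-(b + 1)) (-c) ?_).symm
    · grind
    · intro w hw' z hz'
      obtain ⟨z0, z1, z2⟩ := hz z hz'
      obtain ⟨w0, w1, w2⟩ := hw w hw'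
      have hG : Gdir 0 1 z w = -(1 / (z * (w + 1))) := by simp [Gdir]
      simp only [Rfun, hG, GT, h1, h2, h3, zpow_sub_one₀ z1, zpow_sub_one₀ z2,
        zpow_sub_one₀ w0, zpow_neg, zpow_add_one₀ z0, zpow_add_one₀ w1]
      field_simp
  · refine Eq.trans ?_ (circleIntegral_mul_eq hr1 hr2 (1 - Complex.I)
      (-a) (b - 1) (c - 1) (a - 1) (-(b + 1)) (-c) ?_).symm
    · grind
    · intro w hw' z hz'
      obtain ⟨z0, z1, z2⟩ := hz z hz'
      obtain ⟨w0, w1, w2⟩ := hw w hw'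
      have hG : Gdir (-1) 0 z w = 1 / (w + 1) := by simp [Gdir]
      simp only [Rfun, hG, GT, h1, h2, h3, zpow_sub_one₀ z1, zpow_sub_one₀ z2,
        zpow_sub_one₀ w0, zpow_neg, zpow_add_one₀ w1]
      field_simp
  · refine Eq.trans ?_ (circleIntegral_mul_eq hr1 hr2 (1 - Complex.I)
      (-a) (b - 1) (c - 1) (a - 1) (-b) (-(c + 1)) ?_).symm
    · grind
    · intro w hw' z hz'
      obtain ⟨z0, z1, z2⟩ := hz z hz'
      obtain ⟨w0, w1, w2⟩ := hw w hw'
      have hG : Gdir 0 (-1) z w = 1 / (w - 1) := by simp [Gdir]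
      simp only [Rfun, hG, GT, h1, h2, h3, zpow_sub_one₀ z1, zpow_sub_one₀ z2,
        zpow_sub_one₀ w0, zpow_neg, zpow_add_one₀ w2]
      field_simp

end
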